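/- (Lemma 3.1) Let σ_f, σ_l > 0, let k be the Gaussian kernel on ℝⁿ, let (W, 𝒲) be a measurable space, let P_w be a probability measure on W, and let f : ℝⁿ × W → ℝⁿ be measurable and satisfy ‖f(x, w) − f(x̃, w)‖ ≤ L ‖x − x̃‖ for all x, x̃ ∈ ℝⁿ and w ∈ W, where L ≥ 0. Define the transition kernel T(· | x) := pushforward of P_w under the map w ↦ f(x, w). Then for every η > 0 and all x, x̃ ∈ ℝⁿ with ‖x − x̃‖ ≤ η, one has MMD²(T(· | x̃), T(· | x)) ≤ (σ_f² / σ_l²) · L² η². -/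

import Mathlib

open MeasureTheory

/-- The Gaussian kernel on `ℝⁿ` with parameters `σf, σl`. -/
noncomputable def gaussianKernel (σf σl : ℝ) {n : ℕ}
    (x y : EuclideanSpace ℝ (Fin n)) : ℝ :=
  σf ^ 2 * Real.exp (-‖x - y‖ ^ 2 / (2 * σl ^ 2))

/-- Squared maximum mean discrepancy w.r.t. the kernel `k`. -/
noncomputable def mmdSq {n : ℕ}
    (k : EuclideanSpace ℝ (Fin n) → EuclideanSpace ℝ (Fin n) → ℝ)
    (P Q : Measure (EuclideanSpace ℝ (Fin n))) : ℝ :=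
  (∫ y, (∫ y', k y y' ∂P) ∂P) + (∫ y, (∫ y', k y y' ∂Q) ∂Q)
    - 2 * ∫ y, (∫ y', k y y' ∂Q) ∂P

open ProbabilityTheory in
/-- The Gaussian `exp (-‖z‖² / 2)` is a mixture of cosines. -/
lemma integral_cos_inner_stdGaussian {n : ℕ} (z : EuclideanSpace ℝ (Fin n)) :
    ∫ t, Real.cos (inner ℝ t z) ∂(stdGaussian (EuclideanSpace ℝ (Fin n)))
      = Real.exp (-‖z‖ ^ 2 / 2) := by
  have hint : Integrable (fun t : EuclideanSpace ℝ (Fin n) =>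
      Complex.exp ((inner ℝ t z : ℝ) * Complex.I)) (stdGaussian (EuclideanSpace ℝ (Fin n))) := by
    refine Integrable.of_bound (Continuous.aestronglyMeasurable (by fun_prop)) 1 ?_
    exact Filter.Eventually.of_forall fun t => (Complex.norm_exp_ofReal_mul_I _).le
  have h := congrArg Complex.re (charFun_stdGaussian z)
  rw [charFun_apply, ← RCLike.re_eq_complex_re, ← integral_re hint] at h
  simp only [RCLike.re_eq_complex_re, Complex.exp_ofReal_mul_I_re] at h
  rw [h]
  norm_cast

open Real in
lemma cos_sub_four_point (a b c d : ℝ) :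
    cos (a - c) + cos (b - d) - cos (a - d) - cos (b - c) + cos (a - b) + cos (c - d) ≤ 2 := by
  simp only [cos_sub]
  nlinarith [sq_nonneg (cos a - cos b - cos c + cos d), sq_nonneg (sin a - sin b - sin c + sin d),
    sin_sq_add_cos_sq a, sin_sq_add_cos_sq b, sin_sq_add_cos_sq c, sin_sq_add_cos_sq d]

open ProbabilityTheory in
/-- An instance of the positive definiteness of the unit Gaussian. -/
lemma exp_neg_norm_sq_four_point {n : ℕ} (a b c d : EuclideanSpace ℝ (Fin n)) :
    Real.exp (-‖a - c‖ ^ 2 / 2) + Real.exp (-‖b - d‖ ^ 2 / 2) - Real.exp (-‖a - d‖ ^ 2 / 2)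
      - Real.exp (-‖b - c‖ ^ 2 / 2) + Real.exp (-‖a - b‖ ^ 2 / 2)
      + Real.exp (-‖c - d‖ ^ 2 / 2) ≤ 2 := by
  have hint (z : EuclideanSpace ℝ (Fin n)) : Integrable (fun t => Real.cos (inner ℝ t z))
      (stdGaussian (EuclideanSpace ℝ (Fin n))) :=
    Integrable.of_bound (Continuous.aestronglyMeasurable (by fun_prop)) 1
      (Filter.Eventually.of_forall fun t => Real.abs_cos_le_one _)
  simp only [← integral_cos_inner_stdGaussian]
  rw [← integral_add (hint _) (hint _), ← integral_sub (by fun_prop) (hint _),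
    ← integral_sub (by fun_prop) (hint _), ← integral_add (by fun_prop) (hint _),
    ← integral_add (by fun_prop) (hint _)]
  calc _ ≤ ∫ _, (2 : ℝ) ∂(stdGaussian (EuclideanSpace ℝ (Fin n))) := by
        refine integral_mono (by fun_prop) (integrable_const _) fun t => ?_
        simp only [inner_sub_right]
        exact cos_sub_four_point _ _ _ _
    _ = 2 := by simp

lemma gaussianKernel_eq_exp_norm_smul (σf σl : ℝ) {n : ℕ} (x y : EuclideanSpace ℝ (Fin n)) :
    gaussianKernel σf σl x y = σf ^ 2 * Real.exp (-‖σl⁻¹ • x - σl⁻¹ • y‖ ^ 2 / 2) := by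
  rw [gaussianKernel, ← smul_sub, norm_smul, mul_pow, norm_inv, inv_pow, Real.norm_eq_abs, sq_abs]
  congr 2
  ring

lemma gaussianKernel_four_point_le (σf σl : ℝ) {n : ℕ} {r : ℝ}
    {a b c d : EuclideanSpace ℝ (Fin n)} (hab : ‖a - b‖ ≤ r) (hcd : ‖c - d‖ ≤ r) :
    gaussianKernel σf σl a c + gaussianKernel σf σl b d - gaussianKernel σf σl a d
      - gaussianKernel σf σl b c ≤ σf ^ 2 / σl ^ 2 * r ^ 2 := by
  have key (x y : EuclideanSpace ℝ (Fin n)) (h : ‖x - y‖ ≤ r) :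
      1 - r ^ 2 / σl ^ 2 / 2 ≤ Real.exp (-‖σl⁻¹ • x - σl⁻¹ • y‖ ^ 2 / 2) := by
    have hsq : ‖x - y‖ ^ 2 / σl ^ 2 ≤ r ^ 2 / σl ^ 2 := by gcongr
    have hnorm : ‖σl⁻¹ • x - σl⁻¹ • y‖ ^ 2 = ‖x - y‖ ^ 2 / σl ^ 2 := by
      rw [← smul_sub, norm_smul, mul_pow, norm_inv, inv_pow, Real.norm_eq_abs, sq_abs]
      ring
    have := Real.add_one_le_exp (-‖σl⁻¹ • x - σl⁻¹ • y‖ ^ 2 / 2)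
    rw [hnorm] at this ⊢
    linarith
  have h4 := exp_neg_norm_sq_four_point (σl⁻¹ • a) (σl⁻¹ • b) (σl⁻¹ • c) (σl⁻¹ • d)
  have h1 := key a b hab
  have h2 := key c d hcd
  simp only [gaussianKernel_eq_exp_norm_smul]
  rw [← mul_add, ← mul_sub, ← mul_sub, div_mul_eq_mul_div, mul_div_assoc]
  exact mul_le_mul_of_nonneg_left (by linarith) (sq_nonneg σf)

lemma gaussianKernel_comm (σf σl : ℝ) {n : ℕ} (x y : EuclideanSpace ℝ (Fin n)) :
    gaussianKernel σf σl x y = gaussianKernel σf σl y x := by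
  simp only [gaussianKernel, norm_sub_rev]

lemma continuous_gaussianKernel (σf σl : ℝ) {n : ℕ} :
    Continuous fun p : EuclideanSpace ℝ (Fin n) × EuclideanSpace ℝ (Fin n) =>
      gaussianKernel σf σl p.1 p.2 := by
  unfold gaussianKernel
  fun_prop

lemma norm_gaussianKernel_le (σf σl : ℝ) {n : ℕ} (x y : EuclideanSpace ℝ (Fin n)) :
    ‖gaussianKernel σf σl x y‖ ≤ σf ^ 2 := by
  rw [gaussianKernel, Real.norm_of_nonneg (by positivity)]
  refine mul_le_of_le_one_right (sq_nonneg _) (Real.exp_le_one_iff.2 ?_)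
  rw [neg_div]
  exact neg_nonpos.2 (by positivity)

section Pushforward

variable {n : ℕ} {W : Type*} [MeasurableSpace W] {Pw : Measure W} [IsProbabilityMeasure Pw]
  {g h : W → EuclideanSpace ℝ (Fin n)}

lemma integrable_gaussianKernel_prod (σf σl : ℝ) (hg : Measurable g) (hh : Measurable h) :
    Integrable (fun p : W × W => gaussianKernel σf σl (g p.1) (h p.2)) (Pw.prod Pw) := by
  refine Integrable.of_bound ?_ (σf ^ 2)
    (Filter.Eventually.of_forall fun p => norm_gaussianKernel_le _ _ _ _)
  exact ((continuous_gaussianKernel σf σl).measurable.comp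
    ((hg.comp measurable_fst).prodMk (hh.comp measurable_snd))).aestronglyMeasurable

lemma integral_integral_gaussianKernel_map (σf σl : ℝ) (hg : Measurable g) (hh : Measurable h) :
    ∫ y, (∫ y', gaussianKernel σf σl y y' ∂(Pw.map h)) ∂(Pw.map g)
      = ∫ p, gaussianKernel σf σl (g p.1) (h p.2) ∂(Pw.prod Pw) := by
  have : IsProbabilityMeasure (Pw.map h) := Measure.isProbabilityMeasure_map hh.aemeasurable
  have hk := (continuous_gaussianKernel σf σl (n := n)).stronglyMeasurable
  rw [integral_map hg.aemeasurable hk.integral_prod_right'.aestronglyMeasurable,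
    integral_prod _ (integrable_gaussianKernel_prod σf σl hg hh)]
  refine integral_congr_ae (Filter.Eventually.of_forall fun w => ?_)
  exact integral_map hh.aemeasurable
    (hk.comp_measurable measurable_prodMk_left).aestronglyMeasurable

lemma integral_gaussianKernel_prod_swap (σf σl : ℝ) (g h : W → EuclideanSpace ℝ (Fin n)) :
    ∫ p, gaussianKernel σf σl (g p.1) (h p.2) ∂(Pw.prod Pw)
      = ∫ p, gaussianKernel σf σl (h p.1) (g p.2) ∂(Pw.prod Pw) := by
  rw [← integral_prod_swap]
  simp only [Prod.fst_swap, Prod.snd_swap, gaussianKernel_comm σf σl (g _)]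

/-- Pushforwards along two uniformly close maps are close in MMD. -/
lemma mmdSq_gaussianKernel_map_le (σf σl : ℝ) (hg : Measurable g) (hh : Measurable h) {r : ℝ}
    (hr : ∀ w, ‖g w - h w‖ ≤ r) :
    mmdSq (gaussianKernel σf σl) (Pw.map g) (Pw.map h) ≤ σf ^ 2 / σl ^ 2 * r ^ 2 := by
  have hgg := integrable_gaussianKernel_prod (Pw := Pw) σf σl hg hg
  have hhh := integrable_gaussianKernel_prod (Pw := Pw) σf σl hh hh
  have hgh := integrable_gaussianKernel_prod (Pw := Pw) σf σl hg hh
  have hhg := integrable_gaussianKernel_prod (Pw := Pw) σf σl hh hg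
  rw [mmdSq, integral_integral_gaussianKernel_map σf σl hg hg,
    integral_integral_gaussianKernel_map σf σl hh hh,
    integral_integral_gaussianKernel_map σf σl hg hh, two_mul, ← sub_sub]
  nth_rw 2 [integral_gaussianKernel_prod_swap σf σl g h]
  rw [← integral_add hgg hhh, ← integral_sub (by fun_prop) hgh,
    ← integral_sub (by fun_prop) hhg]
  calc _ ≤ ∫ _, σf ^ 2 / σl ^ 2 * r ^ 2 ∂(Pw.prod Pw) :=
        integral_mono (by fun_prop) (integrable_const _) fun p =>
          gaussianKernel_four_point_le σf σl (hr p.1) (hr p.2)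
    _ = _ := by simp

end Pushforward

theorem mmdSq_lipschitz_dynamics_bound {n : ℕ} (σf σl : ℝ)
    (hσf : 0 < σf) (hσl : 0 < σl)
    (k : EuclideanSpace ℝ (Fin n) → EuclideanSpace ℝ (Fin n) → ℝ)
    (hk : k = gaussianKernel σf σl)
    {W : Type*} [MeasurableSpace W] (Pw : Measure W) [IsProbabilityMeasure Pw]
    (f : EuclideanSpace ℝ (Fin n) → W → EuclideanSpace ℝ (Fin n))
    (hf : ∀ x, Measurable (f x))
    (L : ℝ) (hL : 0 ≤ L)
    (hLip : ∀ x x' : EuclideanSpace ℝ (Fin n), ∀ w : W,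
      ‖f x w - f x' w‖ ≤ L * ‖x - x'‖)
    (T : EuclideanSpace ℝ (Fin n) → Measure (EuclideanSpace ℝ (Fin n)))
    (hT : ∀ x, T x = Pw.map (fun w => f x w))
    (η : ℝ) (hη : 0 < η) :
    ∀ x x' : EuclideanSpace ℝ (Fin n), ‖x - x'‖ ≤ η →
      mmdSq k (T x') (T x) ≤ (σf ^ 2 / σl ^ 2) * L ^ 2 * η ^ 2 := by
  intro x x' hx
  rw [hk, hT, hT, mul_assoc, ← mul_pow]
  refine mmdSq_gaussianKernel_map_le σf σl (hf x') (hf x) fun w => ?_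
  rw [norm_sub_rev]
  exact (hLip x x' w).trans (mul_le_mul_of_nonneg_left hx hL)
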